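/- Let k be an algebraically closed field with char k ≠ 2. Let α, β, γ, α', β', γ' ∈ k with α + β + γ ≠ 0 and α' + β' + γ' ≠ 0. Then there is a graded isomorphism T(α,β,γ) ≅ T(α',β',γ') if and only if there exist a nonzero scalar λ ∈ k and a permutation π of the triple (α,β,γ) such that (α',β',γ') = λ·π(α,β,γ). -/

import Mathlib

noncomputable section

/-- The free algebra on three generators `x, y, z` (indexed by `Fin 3`). -/
abbrev F3 (k : Type) [Field k] : Type := FreeAlgebra k (Fin 3)

noncomputable def X (k : Type) [Field k] : F3 k := FreeAlgebra.ι k 0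
noncomputable def Y (k : Type) [Field k] : F3 k := FreeAlgebra.ι k 1
noncomputable def Z (k : Type) [Field k] : F3 k := FreeAlgebra.ι k 2

/-- The quotient of the free algebra on `x, y, z` by the two-sided ideal
generated by the set `rels`. -/
abbrev quotAlg (k : Type) [Field k] (rels : Set (F3 k)) : Type :=
  RingQuot (fun a b : F3 k => a ∈ rels ∧ b = 0)

/-- The image of the `i`-th generator in the quotient algebra. -/
noncomputable def gen (k : Type) [Field k] (rels : Set (F3 k)) (i : Fin 3) :
    quotAlg k rels :=
  RingQuot.mkAlgHom k (fun a b : F3 k => a ∈ rels ∧ b = 0) (FreeAlgebra.ι k i)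

/-- The `k`-linear span of the images of the generators in the quotient. -/
noncomputable def genSpan (k : Type) [Field k] (rels : Set (F3 k)) :
    Submodule k (quotAlg k rels) :=
  Submodule.span k (Set.range (gen k rels))

/-- There is a graded isomorphism between the two quotient algebras:
a `k`-algebra isomorphism carrying the span of the generators onto the
span of the generators. -/
def GradedIso (k : Type) [Field k] (r1 r2 : Set (F3 k)) : Prop :=
  ∃ φ : quotAlg k r1 ≃ₐ[k] quotAlg k r2,
    Submodule.map φ.toLinearMap (genSpan k r1) = genSpan k r2

/-- Relations of `T(α,β,γ)` (case O(1)(i)):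
`⟨xy − yx, xz − zx − β·x² + (β+γ)·xy, yz − zy − α·y² + (α+γ)·xy⟩`. -/
noncomputable def Tabc (k : Type) [Field k] (α β γ : k) : Set (F3 k) :=
  {X k * Y k - Y k * X k,
   X k * Z k - Z k * X k - β • X k ^ 2 + (β + γ) • (X k * Y k),
   Y k * Z k - Z k * Y k - α • Y k ^ 2 + (α + γ) • (X k * Y k)}

/-- The linear combination of the generators with coefficients `c`. -/
def genComb (k : Type) [Field k] (r : Set (F3 k)) (c : Fin 3 → k) : quotAlg k r :=
  ∑ i, c i • gen k r i

/-- The algebra map out of a quotient of the free algebra given by images of the generators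
that satisfy the relations. -/
def quotLift {k : Type} [Field k] {r : Set (F3 k)} {A : Type} [Ring A] [Algebra k A]
    (f : Fin 3 → A) (hf : ∀ a ∈ r, FreeAlgebra.lift k f a = 0) : quotAlg k r →ₐ[k] A :=
  RingQuot.liftAlgHom k ⟨FreeAlgebra.lift k f, by
    rintro a b ⟨ha, rfl⟩
    rw [hf a ha, map_zero]⟩

@[simp]
theorem quotLift_gen {k : Type} [Field k] {r : Set (F3 k)} {A : Type} [Ring A] [Algebra k A]
    (f : Fin 3 → A) (hf : ∀ a ∈ r, FreeAlgebra.lift k f a = 0) (i : Fin 3) :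
    quotLift f hf (gen k r i) = f i := by
  simp [quotLift, gen]

theorem quotAlg_algHom_ext {k : Type} [Field k] {r : Set (F3 k)} {A : Type} [Ring A]
    [Algebra k A] {f g : quotAlg k r →ₐ[k] A} (h : ∀ i, f (gen k r i) = g (gen k r i)) :
    f = g := by
  apply RingQuot.ringQuot_ext'
  apply FreeAlgebra.hom_ext
  funext i
  exact h i

/-- The relations of `T(α,β,γ)` for the images of the generators under a map to `A`. -/
theorem lift_Tabc_eq_zero {k : Type} [Field k] {α β γ : k} {A : Type} [Ring A] [Algebra k A]
    (f : Fin 3 → A) (hxy : f 0 * f 1 - f 1 * f 0 = 0)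
    (hxz : f 0 * f 2 - f 2 * f 0 - β • (f 0 * f 0) + (β + γ) • (f 0 * f 1) = 0)
    (hyz : f 1 * f 2 - f 2 * f 1 - α • (f 1 * f 1) + (α + γ) • (f 0 * f 1) = 0) :
    ∀ a ∈ Tabc k α β γ, FreeAlgebra.lift k f a = 0 := by
  rintro a (rfl | rfl | rfl) <;> simpa [X, Y, Z, pow_two]

theorem mkAlgHom_eq_zero {k : Type} [Field k] {r : Set (F3 k)} {a : F3 k} (ha : a ∈ r) :
    RingQuot.mkAlgHom k (fun a b : F3 k => a ∈ r ∧ b = 0) a = 0 := by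
  rw [RingQuot.mkAlgHom_rel k (s := fun a b : F3 k => a ∈ r ∧ b = 0) ⟨ha, rfl⟩, map_zero]

section Relations

variable {k : Type} [Field k] (α β γ : k)

theorem gen_comm_xy : gen k (Tabc k α β γ) 0 * gen k (Tabc k α β γ) 1
    - gen k (Tabc k α β γ) 1 * gen k (Tabc k α β γ) 0 = 0 := by
  have h := mkAlgHom_eq_zero (r := Tabc k α β γ) (Or.inl rfl)
  simpa [X, Y, gen] using h

theorem gen_comm_xz : gen k (Tabc k α β γ) 0 * gen k (Tabc k α β γ) 2
    - gen k (Tabc k α β γ) 2 * gen k (Tabc k α β γ) 0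
    - β • (gen k (Tabc k α β γ) 0 * gen k (Tabc k α β γ) 0)
    + (β + γ) • (gen k (Tabc k α β γ) 0 * gen k (Tabc k α β γ) 1) = 0 := by
  have h := mkAlgHom_eq_zero (r := Tabc k α β γ) (Or.inr (Or.inl rfl))
  simpa only [X, Y, Z, gen, pow_two, map_add, map_sub, map_mul, map_smul] using h

theorem gen_comm_yz : gen k (Tabc k α β γ) 1 * gen k (Tabc k α β γ) 2
    - gen k (Tabc k α β γ) 2 * gen k (Tabc k α β γ) 1
    - α • (gen k (Tabc k α β γ) 1 * gen k (Tabc k α β γ) 1)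
    + (α + γ) • (gen k (Tabc k α β γ) 0 * gen k (Tabc k α β γ) 1) = 0 := by
  have h := mkAlgHom_eq_zero (r := Tabc k α β γ) (Or.inr (Or.inr rfl))
  simpa only [X, Y, Z, gen, pow_two, map_add, map_sub, map_mul, map_smul] using h

end Relations

/-- The derivation `[·, z]` of `k[x, y]` attached to `T(α,β,γ)`. -/
def polyDer {k : Type} [Field k] (α β γ : k) :
    Derivation k (MvPolynomial (Fin 2) k) (MvPolynomial (Fin 2) k) :=
  MvPolynomial.mkDerivation k
    ![β • (MvPolynomial.X 0 * MvPolynomial.X 0) - (β + γ) • (MvPolynomial.X 0 * MvPolynomial.X 1),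
      α • (MvPolynomial.X 1 * MvPolynomial.X 1) - (α + γ) • (MvPolynomial.X 0 * MvPolynomial.X 1)]

/-- The representation of `T(α,β,γ)` on `k[x, y]` in which `x` and `y` act by multiplication and
`z` acts by `-[·, z]`. -/
def polyRep {k : Type} [Field k] (α β γ : k) :
    quotAlg k (Tabc k α β γ) →ₐ[k] Module.End k (MvPolynomial (Fin 2) k) :=
  quotLift ![LinearMap.mulLeft k (MvPolynomial.X 0), LinearMap.mulLeft k (MvPolynomial.X 1),
      -(polyDer α β γ).toLinearMap] <| by
    apply lift_Tabc_eq_zero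
    · refine LinearMap.ext fun p => ?_
      simp
      ring
    · refine LinearMap.ext fun p => ?_
      simp [polyDer, MvPolynomial.mkDerivation_X, MvPolynomial.smul_eq_C_mul]
      ring
    · refine LinearMap.ext fun p => ?_
      simp [polyDer, MvPolynomial.mkDerivation_X, MvPolynomial.smul_eq_C_mul]
      ring

/-- For a point `(s, t)`, act on `1 ∈ k[x, y]` and evaluate at `(s, t)`. -/
theorem exists_functional {k : Type} [Field k] (α β γ s t : k) :
    ∃ F : quotAlg k (Tabc k α β γ) →ₗ[k] k,
      (∀ p, F (genComb k _ p) = p 0 * s + p 1 * t) ∧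
      ∀ p q, F (genComb k _ p * genComb k _ q) =
        (p 0 * s + p 1 * t) * (q 0 * s + q 1 * t)
          - p 2 * (q 0 * (β * s ^ 2 - (β + γ) * (s * t))
            + q 1 * (α * t ^ 2 - (α + γ) * (s * t))) := by
  refine ⟨(MvPolynomial.aeval ![s, t]).toLinearMap ∘ₗ LinearMap.applyₗ 1 ∘ₗ
    (polyRep α β γ).toLinearMap, fun p => ?_, fun p q => ?_⟩
  · simp [genComb, Fin.sum_univ_three, polyRep]
  · simp [genComb, Fin.sum_univ_three, polyRep, polyDer, MvPolynomial.mkDerivation_X]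
    ring

theorem genComb_sub_smul {k : Type} [Field k] (r : Set (F3 k)) (a b : k) (p q : Fin 3 → k) :
    a • genComb k r p - b • genComb k r q = genComb k r (a • p - b • q) := by
  simp only [genComb, Fin.sum_univ_three, Pi.sub_apply, Pi.smul_apply, smul_eq_mul]
  module

theorem gen_eq_genComb {k : Type} [Field k] (r : Set (F3 k)) (i : Fin 3) :
    gen k r i = genComb k r (Pi.single i 1) := by
  simp [genComb, Pi.single_apply]

theorem genComb_eq_zero {k : Type} [Field k] {α β γ : k} (h : α + β + γ ≠ 0) {p : Fin 3 → k}
    (hp : genComb k (Tabc k α β γ) p = 0) : p = 0 := by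
  have key : ∀ s t, p 0 * s + p 1 * t = 0 ∧ ∀ q : Fin 3 → k,
      (p 0 * s + p 1 * t) * (q 0 * s + q 1 * t)
          - p 2 * (q 0 * (β * s ^ 2 - (β + γ) * (s * t))
            + q 1 * (α * t ^ 2 - (α + γ) * (s * t))) = 0 := by
    intro s t
    obtain ⟨F, h₁, h₂⟩ := exists_functional α β γ s t
    refine ⟨by rw [← h₁, hp, map_zero], fun q => by rw [← h₂, hp, zero_mul, map_zero]⟩
  have h0 : p 0 = 0 := by simpa using (key 1 0).1
  have h1 : p 1 = 0 := by simpa using (key 0 1).1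
  have hβ := (key 1 0).2 ![1, 0, 0]
  have hα := (key 0 1).2 ![0, 1, 0]
  have hγ := (key 1 1).2 ![1, 0, 0]
  simp [h0, h1] at hβ hα hγ
  have h2 : p 2 = 0 := by grind
  funext i
  fin_cases i <;> assumption

/-- Two triples agree up to a permutation and a nonzero scalar. -/
def ScaledPerm {k : Type} [Field k] (v v' : Fin 3 → k) : Prop :=
  ∃ lam : k, lam ≠ 0 ∧ ∃ π : Equiv.Perm (Fin 3), ∀ i : Fin 3, v' i = lam * v (π i)

theorem ScaledPerm.symm {k : Type} [Field k] {v v' : Fin 3 → k} (h : ScaledPerm v v') :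
    ScaledPerm v' v := by
  obtain ⟨l, hl, π, hπ⟩ := h
  refine ⟨l⁻¹, inv_ne_zero hl, π⁻¹, fun i => ?_⟩
  simp [hπ, hl]

theorem scaledPerm_of_mul_eq {k : Type} [Field k] {v v' : Fin 3 → k} {l m : k} (hl : l ≠ 0)
    (hm : m ≠ 0) (π : Equiv.Perm (Fin 3)) (h : ∀ i, m * v' i = l * v (π i)) :
    ScaledPerm v v' := by
  refine ⟨l / m, div_ne_zero hl hm, π, fun i => ?_⟩
  rw [div_mul_eq_mul_div, ← h, mul_div_cancel_left₀ _ hm]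

theorem scaledPerm_single {k : Type} [Field k] {i j : Fin 3} {a b : k} (ha : a ≠ 0)
    (hb : b ≠ 0) : ScaledPerm (Pi.single i a) (Pi.single j b) := by
  refine ⟨b / a, div_ne_zero hb ha, Equiv.swap i j, fun l => ?_⟩
  by_cases hl : l = j
  · subst hl
    simp [ha]
  · have : Equiv.swap i j l ≠ i := by
      rw [Ne, Equiv.swap_apply_eq_iff, Equiv.swap_apply_left]
      exact hl
    simp [hl, this]

/-- A triple is concentrated at one index as soon as `[·, z]` kills a nonzero linear form
`p x + q y`. -/
theorem eq_single_of_kernel {k : Type} [Field k] {α β γ p q : k} (h : α + β + γ ≠ 0)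
    (hpq : p ≠ 0 ∨ q ≠ 0)
    (hker : ∀ s t, p * (β * s ^ 2 - (β + γ) * (s * t))
      + q * (α * t ^ 2 - (α + γ) * (s * t)) = 0) :
    ∃ i a, a ≠ 0 ∧ ![α, β, γ] = Pi.single i a := by
  have h₁ := hker 1 0
  have h₂ := hker 0 1
  have h₃ := hker 1 1
  simp at h₁ h₂ h₃
  by_cases hβ : β = 0
  · by_cases hα : α = 0
    · refine ⟨2, γ, by simpa [hα, hβ] using h, ?_⟩
      funext i
      fin_cases i <;> simp [hα, hβ]
    · refine ⟨0, α, hα, ?_⟩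
      have hγ : γ = 0 := by grind
      funext i
      fin_cases i <;> simp [hγ, hβ]
  · refine ⟨1, β, hβ, ?_⟩
    have hγ : γ = 0 := by grind
    have hα : α = 0 := by grind
    funext i
    fin_cases i <;> simp [hγ, hα]

/-- The coefficients of a binary quadratic form are determined by its values. -/
theorem quadratic_coeff_eq_zero {k : Type} [Field k] {a b c : k}
    (h : ∀ s t : k, a * s ^ 2 + b * (s * t) + c * t ^ 2 = 0) : a = 0 ∧ b = 0 ∧ c = 0 := by
  have h₁ := h 1 0
  have h₂ := h 0 1
  have h₃ := h 1 1
  simp at h₁ h₂ h₃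
  grind

/-- A linear change of variables intertwining the derivations attached to two triples, up to a
scalar, forces the triples to agree up to permutation and scaling. -/
theorem scaledPerm_of_intertwine {k : Type} [Field k] {α β γ α' β' γ' a b c d m : k}
    (h : α + β + γ ≠ 0) (hdet : a * d - b * c ≠ 0)
    (hu : ∀ s t, m * (a * (β' * s ^ 2 - (β' + γ') * (s * t))
        + b * (α' * t ^ 2 - (α' + γ') * (s * t)))
      = β * (a * s + b * t) ^ 2 - (β + γ) * ((a * s + b * t) * (c * s + d * t)))
    (hv : ∀ s t, m * (c * (β' * s ^ 2 - (β' + γ') * (s * t))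
        + d * (α' * t ^ 2 - (α' + γ') * (s * t)))
      = α * (c * s + d * t) ^ 2 - (α + γ) * ((a * s + b * t) * (c * s + d * t))) :
    ScaledPerm ![α, β, γ] ![α', β', γ'] := by
  obtain ⟨u1, u2, u3⟩ := quadratic_coeff_eq_zero
    (a := m * a * β' - (β * a ^ 2 - (β + γ) * (a * c)))
    (b := -m * (a * (β' + γ') + b * (α' + γ')) - (2 * β * a * b - (β + γ) * (a * d + b * c)))
    (c := m * b * α' - (β * b ^ 2 - (β + γ) * (b * d)))
    (fun s t => by linear_combination hu s t)
  obtain ⟨v1, v2, v3⟩ := quadratic_coeff_eq_zero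
    (a := m * c * β' - (α * c ^ 2 - (α + γ) * (a * c)))
    (b := -m * (c * (β' + γ') + d * (α' + γ')) - (2 * α * c * d - (α + γ) * (a * d + b * c)))
    (c := m * d * α' - (α * d ^ 2 - (α + γ) * (b * d)))
    (fun s t => by linear_combination hv s t)
  have hx : a * c * (c - a) = 0 := by
    refine (mul_eq_zero.mp ?_).resolve_left h
    linear_combination c * u1 - a * v1
  have hy : b * d * (d - b) = 0 := by
    refine (mul_eq_zero.mp ?_).resolve_left h
    linear_combination d * u3 - b * v3
  have hxy : a * c * (d - b) + b * d * (c - a) + (a * d + b * c) * (c - a + d - b) = 0 := by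
    refine (mul_eq_zero.mp ?_).resolve_left h
    linear_combination c * u2 + d * u1 - a * v2 - b * v1 + c * u3 + d * u2 - a * v3 - b * v2
  have hm : m ≠ 0 := by
    rintro rfl
    simp only [zero_mul] at hu hv
    have e₁ := hu d (-c)
    have e₂ := hv (-b) a
    have e₃ := hu (d - b) (a - c)
    have hβ : β = 0 := by
      refine (mul_eq_zero.mp ?_).resolve_right (pow_ne_zero 2 hdet)
      linear_combination -e₁
    have hα : α = 0 := by
      refine (mul_eq_zero.mp ?_).resolve_right (pow_ne_zero 2 hdet)
      linear_combination -e₂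
    have hγ : γ = 0 := by
      refine (mul_eq_zero.mp ?_).resolve_right (pow_ne_zero 2 hdet)
      linear_combination e₃
    exact h (by simp [hα, hβ, hγ])
  have build : ∀ (l : k) (π : Equiv.Perm (Fin 3)), l ≠ 0 →
      m * α' = l * ![α, β, γ] (π 0) → m * β' = l * ![α, β, γ] (π 1) →
      m * γ' = l * ![α, β, γ] (π 2) → ScaledPerm ![α, β, γ] ![α', β', γ'] :=
    fun l π hl h₀ h₁ h₂ => scaledPerm_of_mul_eq hl hm π fun i => by
      fin_cases i <;> assumption
  have p₂ : Equiv.swap (0 : Fin 3) 1 2 = 2 := by decide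
  have q₁ : Equiv.swap (0 : Fin 3) 2 1 = 1 := by decide
  have r₀ : Equiv.swap (1 : Fin 3) 2 0 = 0 := by decide
  rcases mul_eq_zero.mp hx with hac | hac
  · rcases mul_eq_zero.mp hac with rfl | rfl
    · have hb : b ≠ 0 := by grind
      rcases mul_eq_zero.mp hy with hbd | hbd
      · obtain rfl : d = 0 := by grind
        obtain rfl : c = b := by grind
        apply build c (Equiv.swap 0 1) hb <;> simp [p₂] <;> grind
      · obtain rfl : d = b := by grind
        obtain rfl : c = -d := by grind
        apply build (-d) (Equiv.swap 0 1 * Equiv.swap 0 2) (neg_ne_zero.mpr hb) <;>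
          simp [p₂, q₁] <;> grind
    · have ha : a ≠ 0 := by grind
      rcases mul_eq_zero.mp hy with hbd | hbd
      · obtain rfl : b = 0 := by grind
        obtain rfl : d = a := by grind
        apply build d 1 ha <;> simp <;> grind
      · obtain rfl : d = b := by grind
        obtain rfl : a = -d := by grind
        apply build (-d) (Equiv.swap 0 2) ha <;> simp [q₁] <;> grind
  · obtain rfl : c = a := by grind
    have ha : c ≠ 0 := by grind
    rcases mul_eq_zero.mp hy with hbd | hbd
    · rcases mul_eq_zero.mp hbd with rfl | rfl
      · obtain rfl : d = -c := by grind
        apply build (-c) (Equiv.swap 1 2) (neg_ne_zero.mpr ha) <;> simp [r₀] <;> grind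
      · obtain rfl : b = -c := by grind
        apply build (-c) (Equiv.swap 0 2 * Equiv.swap 0 1) (neg_ne_zero.mpr ha) <;>
          simp [p₂, q₁] <;> grind
    · grind

theorem exists_genComb_eq {k : Type} [Field k] {r : Set (F3 k)} {x : quotAlg k r}
    (hx : x ∈ genSpan k r) : ∃ c, genComb k r c = x :=
  (Submodule.mem_span_range_iff_exists_fun k).mp hx

/-- A graded isomorphism either preserves the span of `x` and `y`, in which case the parameters
agree up to permutation and scaling, or the target parameters are concentrated at one index. -/
theorem scaledPerm_or_single {k : Type} [Field k] {α β γ α' β' γ' : k}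
    (h : α + β + γ ≠ 0) (h' : α' + β' + γ' ≠ 0)
    (hiso : GradedIso k (Tabc k α β γ) (Tabc k α' β' γ')) :
    ScaledPerm ![α, β, γ] ![α', β', γ'] ∨ ∃ i a, a ≠ 0 ∧ ![α', β', γ'] = Pi.single i a := by
  obtain ⟨φ, hφ⟩ := hiso
  have himg : ∀ i, ∃ c, genComb k _ c = φ (gen k _ i) := fun i =>
    exists_genComb_eq (hφ ▸ Submodule.mem_map_of_mem (Submodule.subset_span ⟨i, rfl⟩))
  obtain ⟨u, hu⟩ := himg 0
  obtain ⟨v, hv⟩ := himg 1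
  obtain ⟨w, hw⟩ := himg 2
  have hindep : ∀ a b : k, a • u - b • v = 0 → a = 0 ∧ b = 0 := by
    intro a b hab
    have h₁ : φ (genComb k _ (a • Pi.single 0 1 - b • Pi.single 1 1)) = 0 := by
      rw [← genComb_sub_smul, ← gen_eq_genComb, ← gen_eq_genComb, map_sub, map_smul, map_smul,
        ← hu, ← hv, genComb_sub_smul, hab]
      simp [genComb]
    have h₂ := genComb_eq_zero h ((map_eq_zero_iff φ φ.injective).mp h₁)
    have h₃ := congrFun h₂ 0
    have h₄ := congrFun h₂ 1
    simpa using And.intro h₃ h₄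
  have hxy := congrArg φ (gen_comm_xy α β γ)
  have hxz := congrArg φ (gen_comm_xz α β γ)
  have hyz := congrArg φ (gen_comm_yz α β γ)
  simp only [map_add, map_sub, map_mul, map_smul, map_zero, ← hu, ← hv, ← hw] at hxy hxz hyz
  by_cases h2 : u 2 = 0 ∧ v 2 = 0
  · obtain ⟨hu2, hv2⟩ := h2
    left
    have hU : ∀ s t, w 2 * (u 0 * (β' * s ^ 2 - (β' + γ') * (s * t))
          + u 1 * (α' * t ^ 2 - (α' + γ') * (s * t)))
        = β * (u 0 * s + u 1 * t) ^ 2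
          - (β + γ) * ((u 0 * s + u 1 * t) * (v 0 * s + v 1 * t)) := by
      intro s t
      obtain ⟨F, -, hF⟩ := exists_functional α' β' γ' s t
      have := congrArg F hxz
      simp only [map_add, map_sub, map_smul, map_zero, hF, hu2, smul_eq_mul] at this
      linear_combination this
    have hV : ∀ s t, w 2 * (v 0 * (β' * s ^ 2 - (β' + γ') * (s * t))
          + v 1 * (α' * t ^ 2 - (α' + γ') * (s * t)))
        = α * (v 0 * s + v 1 * t) ^ 2
          - (α + γ) * ((u 0 * s + u 1 * t) * (v 0 * s + v 1 * t)) := by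
      intro s t
      obtain ⟨F, -, hF⟩ := exists_functional α' β' γ' s t
      have := congrArg F hyz
      simp only [map_add, map_sub, map_smul, map_zero, hF, hu2, hv2, smul_eq_mul] at this
      linear_combination this
    have hdet : u 0 * v 1 - u 1 * v 0 ≠ 0 := by
      intro hd
      have e₁ := hindep (v 1) (u 1) (by
        funext i; fin_cases i <;> simp [hu2, hv2] <;> grind)
      have e₂ := hindep (v 0) (u 0) (by
        funext i; fin_cases i <;> simp [hu2, hv2] <;> grind)
      have e₃ := hindep 1 0 (by
        funext i; fin_cases i <;> simp [hu2, e₁, e₂])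
      exact one_ne_zero e₃.1
    exact scaledPerm_of_intertwine h hdet hU hV
  · right
    refine eq_single_of_kernel (p := v 2 * u 0 - u 2 * v 0) (q := v 2 * u 1 - u 2 * v 1) h' ?_ ?_
    · by_contra! hc
      have := hindep (v 2) (u 2) (by
        funext i; fin_cases i <;> simp [hc, mul_comm (v 2) (u 2)])
      exact h2 this.symm
    · intro s t
      obtain ⟨F, -, hF⟩ := exists_functional α' β' γ' s t
      have := congrArg F hxy
      simp only [map_sub, map_zero, hF] at this
      linear_combination this

theorem GradedIso.symm {k : Type} [Field k] {r₁ r₂ : Set (F3 k)} (h : GradedIso k r₁ r₂) :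
    GradedIso k r₂ r₁ := by
  obtain ⟨φ, hφ⟩ := h
  refine ⟨φ.symm, ?_⟩
  rw [← hφ, ← Submodule.map_comp]
  convert Submodule.map_id _
  ext x
  simp

theorem GradedIso.trans {k : Type} [Field k] {r₁ r₂ r₃ : Set (F3 k)} (h : GradedIso k r₁ r₂)
    (h' : GradedIso k r₂ r₃) : GradedIso k r₁ r₃ := by
  obtain ⟨φ, hφ⟩ := h
  obtain ⟨ψ, hψ⟩ := h'
  refine ⟨φ.trans ψ, ?_⟩
  rw [← hψ, ← hφ, ← Submodule.map_comp]
  rfl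

/-- Mutually inverse algebra maps that send generators to linear forms give a graded
isomorphism. -/
theorem gradedIso_of_algHoms {k : Type} [Field k] {r₁ r₂ : Set (F3 k)}
    (φ : quotAlg k r₁ →ₐ[k] quotAlg k r₂) (ψ : quotAlg k r₂ →ₐ[k] quotAlg k r₁)
    (hφ : ∀ i, φ (gen k r₁ i) ∈ genSpan k r₂) (hψ : ∀ i, ψ (gen k r₂ i) ∈ genSpan k r₁)
    (hψφ : ∀ i, ψ (φ (gen k r₁ i)) = gen k r₁ i) (hφψ : ∀ i, φ (ψ (gen k r₂ i)) = gen k r₂ i) :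
    GradedIso k r₁ r₂ := by
  have hφψ' : φ.comp ψ = AlgHom.id k _ := quotAlg_algHom_ext hφψ
  refine ⟨AlgEquiv.ofAlgHom φ ψ hφψ' (quotAlg_algHom_ext hψφ), le_antisymm ?_ ?_⟩
  · rw [Submodule.map_le_iff_le_comap, genSpan, Submodule.span_le]
    rintro _ ⟨i, rfl⟩
    exact hφ i
  · rw [genSpan, Submodule.span_le]
    rintro _ ⟨i, rfl⟩
    exact ⟨ψ (gen k r₂ i), hψ i, hφψ i⟩

theorem gen_mem_genSpan {k : Type} [Field k] (r : Set (F3 k)) (i : Fin 3) :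
    gen k r i ∈ genSpan k r :=
  Submodule.subset_span ⟨i, rfl⟩

section Isomorphisms

variable {k : Type} [Field k] (α β γ : k)

/-- Scaling `z`. -/
def scaleHom {c d : k} (hcd : c * d = 1) :
    quotAlg k (Tabc k α β γ) →ₐ[k] quotAlg k (Tabc k (c * α) (c * β) (c * γ)) :=
  quotLift ![gen k _ 0, gen k _ 1, d • gen k _ 2] <| by
    apply lift_Tabc_eq_zero
    · exact gen_comm_xy _ _ _
    · have h := congrArg (d • ·) (gen_comm_xz (c * α) (c * β) (c * γ))
      simp only [smul_add, smul_sub, smul_zero, smul_smul] at h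
      rw [show d * (c * β) = β by linear_combination β * hcd,
        show d * (c * β + c * γ) = β + γ by linear_combination (β + γ) * hcd] at h
      simpa using h
    · have h := congrArg (d • ·) (gen_comm_yz (c * α) (c * β) (c * γ))
      simp only [smul_add, smul_sub, smul_zero, smul_smul] at h
      rw [show d * (c * α) = α by linear_combination α * hcd,
        show d * (c * α + c * γ) = α + γ by linear_combination (α + γ) * hcd] at h
      simpa using h

/-- Exchanging `x` and `y`. -/
def swapHom : quotAlg k (Tabc k α β γ) →ₐ[k] quotAlg k (Tabc k β α γ) :=
  quotLift ![gen k _ 1, gen k _ 0, gen k _ 2] <| by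
    have hc := sub_eq_zero.mp (gen_comm_xy β α γ)
    apply lift_Tabc_eq_zero
    · simpa using sub_eq_zero.mpr hc.symm
    · simpa [hc] using gen_comm_yz β α γ
    · simpa [hc] using gen_comm_xz β α γ

variable {α β γ} in
/-- If `x, y, z` satisfy the relations of `T(α,γ,β)`, then `x, x - y, -z` satisfy those of
`T(α,β,γ)`. -/
theorem lift_reflect_eq_zero {A : Type} [Ring A] [Algebra k A] {x y z : A}
    (hxy : x * y - y * x = 0)
    (hxz : x * z - z * x - γ • (x * x) + (γ + β) • (x * y) = 0)
    (hyz : y * z - z * y - α • (y * y) + (α + β) • (x * y) = 0) :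
    ∀ a ∈ Tabc k α β γ, FreeAlgebra.lift k ![x, x - y, -z] a = 0 := by
  apply lift_Tabc_eq_zero
  · simp only [Matrix.cons_val, mul_sub, sub_mul]
    linear_combination (norm := module) -hxy
  · simp only [Matrix.cons_val, mul_sub, mul_neg, neg_mul]
    linear_combination (norm := module) -hxz
  · simp only [Matrix.cons_val, mul_sub, sub_mul, mul_neg, neg_mul]
    linear_combination (norm := module) hyz - hxz - α • hxy

/-- Exchanging `y` and `x - y`, and negating `z`. -/
def reflectHom : quotAlg k (Tabc k α β γ) →ₐ[k] quotAlg k (Tabc k α γ β) :=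
  quotLift ![gen k _ 0, gen k _ 0 - gen k _ 1, -gen k _ 2] <|
    lift_reflect_eq_zero (gen_comm_xy α γ β) (gen_comm_xz α γ β) (gen_comm_yz α γ β)

theorem gradedIso_scale {c : k} (hc : c ≠ 0) :
    GradedIso k (Tabc k α β γ) (Tabc k (c * α) (c * β) (c * γ)) := by
  have hback : ∀ a ∈ Tabc k (c * α) (c * β) (c * γ),
      FreeAlgebra.lift k ![gen k (Tabc k α β γ) 0, gen k (Tabc k α β γ) 1,
        c • gen k (Tabc k α β γ) 2] a = 0 := by
    apply lift_Tabc_eq_zero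
    · exact gen_comm_xy _ _ _
    · have h := congrArg (c • ·) (gen_comm_xz α β γ)
      simpa [smul_sub, smul_smul, mul_add] using h
    · have h := congrArg (c • ·) (gen_comm_yz α β γ)
      simpa [smul_sub, smul_smul, mul_add] using h
  refine gradedIso_of_algHoms (scaleHom α β γ (mul_inv_cancel₀ hc)) (quotLift _ hback)
    ?_ ?_ ?_ ?_ <;> intro i <;> fin_cases i <;>
    simp [scaleHom, gen_mem_genSpan, Submodule.smul_mem, smul_smul, hc]

theorem gradedIso_swap : GradedIso k (Tabc k α β γ) (Tabc k β α γ) := by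
  refine gradedIso_of_algHoms (swapHom α β γ) (swapHom β α γ) ?_ ?_ ?_ ?_ <;>
    intro i <;> fin_cases i <;> simp [swapHom, gen_mem_genSpan]

theorem gradedIso_reflect : GradedIso k (Tabc k α β γ) (Tabc k α γ β) := by
  refine gradedIso_of_algHoms (reflectHom α β γ) (reflectHom α γ β) ?_ ?_ ?_ ?_ <;>
    intro i <;> fin_cases i <;> simp [reflectHom, gen_mem_genSpan, Submodule.sub_mem]

theorem gradedIso_perm (v : Fin 3 → k) (π : Equiv.Perm (Fin 3)) :
    GradedIso k (Tabc k (v 0) (v 1) (v 2)) (Tabc k (v (π 0)) (v (π 1)) (v (π 2))) := by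
  have h01 : π 0 ≠ π 1 := by simp
  have h02 : π 0 ≠ π 2 := by simp
  have h12 : π 1 ≠ π 2 := by simp
  generalize π 0 = i at *
  generalize π 1 = j at *
  generalize π 2 = l at *
  fin_cases i <;> fin_cases j <;> fin_cases l <;> simp at h01 h02 h12 ⊢
  · exact (gradedIso_swap _ _ _).trans (gradedIso_swap _ _ _)
  · exact gradedIso_reflect _ _ _
  · exact gradedIso_swap _ _ _
  · exact (gradedIso_swap _ _ _).trans (gradedIso_reflect _ _ _)
  · exact (gradedIso_reflect _ _ _).trans (gradedIso_swap _ _ _)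
  · exact ((gradedIso_reflect _ _ _).trans (gradedIso_swap _ _ _)).trans (gradedIso_reflect _ _ _)

end Isomorphisms

theorem stmt9 (k : Type) [Field k] [IsAlgClosed k] (hchar : ringChar k ≠ 2)
    (α β γ α' β' γ' : k) (h : α + β + γ ≠ 0) (h' : α' + β' + γ' ≠ 0) :
    GradedIso k (Tabc k α β γ) (Tabc k α' β' γ') ↔
      ∃ lam : k, lam ≠ 0 ∧ ∃ π : Equiv.Perm (Fin 3),
        ∀ i : Fin 3, ![α', β', γ'] i = lam * ![α, β, γ] (π i) := by
  constructor
  · intro hiso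
    obtain hp | ⟨i, a, ha, hi⟩ := scaledPerm_or_single h h' hiso
    · exact hp
    obtain hp | ⟨j, b, hb, hj⟩ := scaledPerm_or_single h' h hiso.symm
    · exact hp.symm
    rw [hi, hj]
    exact scaledPerm_single hb ha
  · rintro ⟨c, hc, π, hπ⟩
    have h0 : α' = _ := hπ 0
    have h1 : β' = _ := hπ 1
    have h2 : γ' = _ := hπ 2
    rw [h0, h1, h2]
    exact (gradedIso_perm ![α, β, γ] π).trans (gradedIso_scale _ _ _ hc)
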